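/- arXiv:1211.0732 — 7 statements merged into one kernel-verified Lean document; each statement's English description precedes it below -/
import Mathlib

section
/- For every integer n ≥ 2, the number of s-extremal set systems 𝓕 ⊆ 2^[n] of VC-dimension at most 1 satisfying ∪_{F∈𝓕} F = [n] and ∩_{F∈𝓕} F = ∅ equals 2^n · (n+1)^{n−2}. -/
open Finset

/-- The family of subsets of `[n]` (identified with `Fin n`) shattered by the
set system `F ⊆ 2^[n]`. -/
def Sh (n : ℕ) (F : Finset (Finset (Fin n))) : Finset (Finset (Fin n)) :=
  Finset.univ.filter (fun S => ∀ H ∈ S.powerset, ∃ A ∈ F, A ∩ S = H)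

/-- A set system is shattering-extremal (s-extremal) if it shatters exactly
`|F|` sets. -/
def SExtremal (n : ℕ) (F : Finset (Finset (Fin n))) : Prop :=
  (Sh n F).card = F.card

/-- The inclusion graph of a set system: vertices are the members of `F`,
two sets adjacent iff their symmetric difference is a single element. -/
def inclGraph (n : ℕ) (F : Finset (Finset (Fin n))) : SimpleGraph {A // A ∈ F} where
  Adj A B := (symmDiff A.1 B.1).card = 1
  symm := by constructor; intro A B h; rwa [symmDiff_comm]
  loopless := by constructor; intro A h; simp [symmDiff_self] at h

/-- A parent map on `V` with roots attached to `K` is acyclic if some rank function strictly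
decreases from each vertex to its parent. -/
def IsAcyclicParent {V K : Type*} (p : V → V ⊕ K) : Prop :=
  ∃ h : V → ℕ, ∀ a b, p a = Sum.inl b → h b < h a

theorem choose_sum_eq_add_pow (m k : ℕ) :
    ∑ s ∈ range (m + 2), (m + 1).choose s *
      (k ^ s * if m + 1 - s = 0 then 1 else s * (m + 1) ^ (m - s)) = k * (m + 1 + k) ^ m := by
  have hm : 0 < m + 1 := m.succ_pos
  apply Nat.eq_of_mul_eq_mul_left hm
  rw [sum_range_succ', add_comm (m + 1) k, add_pow k, mul_add, mul_sum, mul_sum, mul_sum]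
  simp only [Nat.sub_zero, Nat.add_eq_zero_iff, one_ne_zero, and_false, if_false, zero_mul,
    mul_zero, add_zero]
  refine sum_congr rfl fun t ht => ?_
  have htm : t ≤ m := by simpa [Nat.lt_succ_iff] using ht
  have key : (m + 1) * (if m + 1 - (t + 1) = 0 then 1 else (t + 1) * (m + 1) ^ (m - (t + 1))) =
      (t + 1) * (m + 1) ^ (m - t) := by
    rcases htm.eq_or_lt with rfl | h
    · simp
    · rw [if_neg (by omega), show m - t = (m - (t + 1)) + 1 by omega, pow_succ]
      ring
  calc (m + 1) * ((m + 1).choose (t + 1) * (k ^ (t + 1) *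
        if m + 1 - (t + 1) = 0 then 1 else (t + 1) * (m + 1) ^ (m - (t + 1))))
      = (m + 1).choose (t + 1) * k ^ (t + 1) * ((m + 1) *
        if m + 1 - (t + 1) = 0 then 1 else (t + 1) * (m + 1) ^ (m - (t + 1))) := by ring
    _ = ((m + 1).choose (t + 1) * (t + 1)) * k ^ (t + 1) * (m + 1) ^ (m - t) := by
        rw [key]; ring
    _ = _ := by rw [← Nat.add_one_mul_choose_eq, Nat.cast_id]; ring

open Classical in
/-- Acyclic parent maps whose set of children of `K` is exactly `S`. -/
noncomputable def acyclicParentEquiv {V K : Type*} (S : Finset V) :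
    {p : V → V ⊕ K // IsAcyclicParent p ∧ ∀ v, v ∈ S ↔ (p v).isRight} ≃
      (S → K) × {q : {v // v ∉ S} → {v // v ∉ S} ⊕ S // IsAcyclicParent q} where
  toFun p := (fun s => (p.1 s).getRight ((p.2.2 s).1 s.2),
    ⟨fun w =>
      let u := (p.1 w).getLeft (by simpa using fun h => w.2 ((p.2.2 w).2 h))
      if hu : u ∈ S then Sum.inr ⟨u, hu⟩ else Sum.inl ⟨u, hu⟩, by
      obtain ⟨h, hh⟩ := p.2.1
      refine ⟨fun v => h v, fun a b hab => hh _ _ ?_⟩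
      dsimp only at hab
      split_ifs at hab
      obtain rfl := Sum.inl.inj hab
      simp⟩)
  invFun dq := ⟨fun v => if hv : v ∈ S then Sum.inr (dq.1 ⟨v, hv⟩) else
      Sum.inl (Sum.elim Subtype.val Subtype.val (dq.2.1 ⟨v, hv⟩)), by
    obtain ⟨d, q, h, hh⟩ := dq
    refine ⟨⟨fun v => if hv : v ∈ S then 0 else h ⟨v, hv⟩ + 1, fun a b hab => ?_⟩, fun v => ?_⟩
    · dsimp only at hab
      split_ifs at hab with ha
      have hab := Sum.inl.inj hab
      rcases hq : q ⟨a, ha⟩ with c | c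
      · rw [hq] at hab
        obtain rfl : c.1 = b := hab
        simpa [ha, c.2] using hh _ _ hq
      · rw [hq] at hab
        obtain rfl : c.1 = b := hab
        simp [ha]
    · by_cases hv : v ∈ S <;> simp [hv]⟩
  left_inv p := by
    ext v : 2
    by_cases hv : v ∈ S
    · simp [hv]
    · simp only [hv, dite_false]
      split_ifs <;> simp
  right_inv dq := by
    obtain ⟨d, q, hq⟩ := dq
    refine Prod.ext (funext fun s => by simp) (Subtype.ext (funext fun w => ?_))
    rcases h : q w with c | c
    · simp [w.2, h, c.2]
    · simp [w.2, h]

theorem card_isAcyclicParent (n : ℕ) : ∀ (V K : Type) [Fintype V] [Fintype K],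
    Fintype.card V = n → Nat.card {p : V → V ⊕ K // IsAcyclicParent p} =
      if n = 0 then 1 else Fintype.card K * (n + Fintype.card K) ^ (n - 1) := by
  classical
  induction n using Nat.strong_induction_on with
  | _ n ih =>
  intro V K _ _ hV
  rcases n with _ | m
  · have := Fintype.card_eq_zero_iff.1 hV
    have : Unique {p : V → V ⊕ K // IsAcyclicParent p} :=
      { default := ⟨isEmptyElim, fun _ => 0, fun a => isEmptyElim a⟩
        uniq := fun p => Subtype.ext (Subsingleton.elim _ _) }
    simp
  have hfib : Nat.card {p : V → V ⊕ K // IsAcyclicParent p} =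
      ∑ S : Finset V, Nat.card
        {p : V → V ⊕ K // IsAcyclicParent p ∧ ∀ v, v ∈ S ↔ (p v).isRight} := by
    rw [Nat.card_congr (Equiv.sigmaFiberEquiv
      fun p : {p : V → V ⊕ K // IsAcyclicParent p} => univ.filter fun v => (p.1 v).isRight).symm,
      Nat.card_sigma]
    refine sum_congr rfl fun S _ => Nat.card_congr ((Equiv.subtypeSubtypeEquivSubtypeInter
      _ fun p : V → V ⊕ K => (univ.filter fun v => (p v).isRight) = S).trans (Equiv.subtypeEquivRight ?_))
    intro p
    simp [Finset.ext_iff, iff_comm]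
  have hterm : ∀ S : Finset V, Nat.card
      {p : V → V ⊕ K // IsAcyclicParent p ∧ ∀ v, v ∈ S ↔ (p v).isRight} =
      Fintype.card K ^ #S *
        if m + 1 - #S = 0 then 1 else #S * (m + 1) ^ (m - #S) := by
    intro S
    rw [Nat.card_congr (acyclicParentEquiv S), Nat.card_prod]
    congr 1
    · simp
    have hle : #S ≤ m + 1 := hV ▸ card_le_univ S
    have hW : Fintype.card {v // v ∉ S} = m + 1 - #S := by
      rw [Fintype.card_subtype_compl]; simp [hV]
    rcases S.eq_empty_or_nonempty with rfl | hS
    · rw [if_neg (by simp), card_empty, zero_mul, Nat.card_eq_zero]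
      left
      refine ⟨fun ⟨q, h, hh⟩ => ?_⟩
      have : Nonempty {v : V // v ∉ (∅ : Finset V)} :=
        Fintype.card_pos_iff.1 (by rw [hW]; simp)
      obtain ⟨a, ha⟩ := Finite.exists_min h
      rcases hq : q a with b | b
      · exact (hh a b hq).not_ge (ha b)
      · exact notMem_empty _ b.2
    · have hpos := hS.card_pos
      rw [ih (m + 1 - #S) (by omega) _ _ hW]
      rw [Fintype.card_coe, Nat.sub_add_cancel hle, show m + 1 - #S - 1 = m - #S by omega]
  rw [hfib, sum_congr rfl fun S _ => hterm S, if_neg (by simp), ← powerset_univ,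
    sum_powerset_apply_card (fun s => Fintype.card K ^ s *
      if m + 1 - s = 0 then 1 else s * (m + 1) ^ (m - s)), card_univ, hV]
  simpa using choose_sum_eq_add_pow m (Fintype.card K)

open Classical in
/-- The ancestors of `i` under a parent map, including `i` itself. -/
noncomputable def ancestors {V K : Type*} [Fintype V] (p : V → V ⊕ K) (i : V) : Finset V :=
  univ.filter fun j => Relation.ReflTransGen (fun a b => p a = Sum.inl b) i j

section Ancestors

variable {V K : Type*} [Fintype V] {p : V → V ⊕ K} {i j k : V}

theorem mem_ancestors :
    j ∈ ancestors p i ↔ Relation.ReflTransGen (fun a b => p a = Sum.inl b) i j := by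
  simp [ancestors]

theorem mem_ancestors_iff :
    j ∈ ancestors p i ↔ j = i ∨ ∃ c, p i = Sum.inl c ∧ j ∈ ancestors p c := by
  simp only [mem_ancestors]
  rw [Relation.ReflTransGen.cases_head_iff, eq_comm]

theorem self_mem_ancestors : i ∈ ancestors p i := mem_ancestors.2 .refl

theorem ancestors_subset (h : j ∈ ancestors p i) : ancestors p j ⊆ ancestors p i :=
  fun _ hk => mem_ancestors.2 ((mem_ancestors.1 h).trans (mem_ancestors.1 hk))

theorem ancestors_total (hi : i ∈ ancestors p k) (hj : j ∈ ancestors p k) :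
    i ∈ ancestors p j ∨ j ∈ ancestors p i := by
  simp only [mem_ancestors] at *
  exact (Relation.ReflTransGen.total_of_right_unique
    (fun a b c hb hc => Sum.inl.inj (hb.symm.trans hc)) hi hj).symm

namespace IsAcyclicParent

theorem ancestors_antisymm (hp : IsAcyclicParent p) (hi : i ∈ ancestors p j)
    (hj : j ∈ ancestors p i) : i = j := by
  obtain ⟨h, hh⟩ := hp
  have key : ∀ {a b}, b ∈ ancestors p a → b = a ∨ h b < h a := by
    intro a b hab
    rw [mem_ancestors] at hab
    induction hab with
    | refl => exact Or.inl rfl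
    | tail _ hbc ih =>
      rcases ih with rfl | ih
      · exact Or.inr (hh _ _ hbc)
      · exact Or.inr ((hh _ _ hbc).trans ih)
  rcases key hi with h1 | h1
  · exact h1
  · rcases key hj with h2 | h2
    · exact h2.symm
    · omega

theorem ancestors_injective (hp : IsAcyclicParent p) : Function.Injective (ancestors p) :=
  fun _ _ h => hp.ancestors_antisymm (h ▸ self_mem_ancestors) (h ▸ self_mem_ancestors)

variable [DecidableEq V]

theorem erase_ancestors (hp : IsAcyclicParent p) (i : V) :
    (ancestors p i).erase i = Sum.elim (ancestors p) (fun _ => ∅) (p i) := by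
  ext k
  rw [mem_erase, mem_ancestors_iff]
  rcases hi : p i with c | c
  · have : k ∈ ancestors p c → k ≠ i := by
      rintro hk rfl
      have hc : c ∈ ancestors p k := mem_ancestors.2 (.single hi)
      obtain rfl := hp.ancestors_antisymm hk hc
      obtain ⟨h, hh⟩ := hp
      exact (hh _ _ hi).false
    simp
    tauto
  · simp

end IsAcyclicParent

/-- The chains of ancestors determine an acyclic parent map. -/
theorem ancestors_unique [DecidableEq V] {P : V → Finset V}
    (hmem : ∀ i, i ∈ P i) (hP : ∀ i, (P i).erase i = Sum.elim P (fun _ => ∅) (p i)) :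
    IsAcyclicParent p ∧ ancestors p = P := by
  have hp : ∀ a b, p a = Sum.inl b → #(P b) < #(P a) := by
    intro a b hab
    have := hP a
    rw [hab, Sum.elim_inl] at this
    rw [← this]
    exact card_erase_lt_of_mem (hmem a)
  refine ⟨⟨_, hp⟩, funext fun i => ?_⟩
  induction hn : #(P i) using Nat.strong_induction_on generalizing i with
  | _ n ih =>
  ext k
  rw [mem_ancestors_iff, ← insert_erase (hmem i), hP, mem_insert]
  rcases hi : p i with c | c
  · simp [ih _ (hn ▸ hp i c hi) c rfl]
  · simp

end Ancestors

/-- Maximum set systems of VC-dimension at most one. -/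
def IsMaximumVCOne {α : Type*} [Fintype α] [DecidableEq α] (F : Finset (Finset α)) : Prop :=
  #F = Fintype.card α + 1 ∧ ∀ S, F.Shatters S → #S ≤ 1

section SetSystems

variable {α : Type*} [DecidableEq α]

theorem card_filter_card_le_one (s : Finset α) :
    #(s.powerset.filter fun t => #t ≤ 1) = #s + 1 := by
  have : (s.powerset.filter fun t => #t ≤ 1) = powersetCard 0 s ∪ powersetCard 1 s := by
    ext t
    simp only [mem_filter, mem_powerset, mem_union, mem_powersetCard]
    have : #t ≤ 1 ↔ #t = 0 ∨ #t = 1 := by omega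
    tauto
  rw [this, card_union_of_disjoint
    ((pairwise_disjoint_powersetCard s) (by simp : (0 : ℕ) ≠ 1))]
  simp [add_comm]

theorem shatters_pair {F : Finset (Finset α)} {i j : α} {A B C D : Finset α}
    (hA : A ∈ F) (hB : B ∈ F) (hC : C ∈ F) (hD : D ∈ F) (hiA : i ∈ A) (hjA : j ∈ A)
    (hiB : i ∈ B) (hjB : j ∉ B) (hiC : i ∉ C) (hjC : j ∈ C) (hiD : i ∉ D) (hjD : j ∉ D) :
    F.Shatters {i, j} := by
  intro t ht
  have key : ∀ X : Finset α, (i ∈ X ↔ i ∈ t) → (j ∈ X ↔ j ∈ t) → {i, j} ∩ X = t := by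
    intro X hi hj
    ext k
    simp only [mem_inter, mem_insert, mem_singleton]
    constructor
    · rintro ⟨rfl | rfl, hk⟩
      exacts [hi.1 hk, hj.1 hk]
    · intro hk
      have := ht hk
      simp only [mem_insert, mem_singleton] at this
      rcases this with rfl | rfl
      · exact ⟨Or.inl rfl, hi.2 hk⟩
      · exact ⟨Or.inr rfl, hj.2 hk⟩
  by_cases hi : i ∈ t <;> by_cases hj : j ∈ t
  · exact ⟨A, hA, key A (by tauto) (by tauto)⟩
  · exact ⟨B, hB, key B (by tauto) (by tauto)⟩
  · exact ⟨C, hC, key C (by tauto) (by tauto)⟩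
  · exact ⟨D, hD, key D (by tauto) (by tauto)⟩

variable {F : Finset (Finset α)}

theorem Finset.Shatters.image_symmDiff {S : Finset α} (hS : F.Shatters S) (A : Finset α) :
    (F.image (symmDiff A)).Shatters S := by
  intro t ht
  obtain ⟨B, hB, hSB⟩ := hS (t := S ∩ symmDiff A t) inter_subset_left
  refine ⟨_, mem_image_of_mem _ hB, ?_⟩
  ext x
  have := Finset.ext_iff.1 hSB x
  have := @ht x
  simp only [mem_inter, mem_symmDiff] at *
  tauto

theorem image_symmDiff_image_symmDiff (A : Finset α) :
    (F.image (symmDiff A)).image (symmDiff A) = F := by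
  rw [image_image]
  simp [Function.comp_def]

variable [Fintype α]

namespace IsMaximumVCOne

theorem eq_of_patterns (hF : IsMaximumVCOne F) (h0 : ∅ ∈ F) {i j : α} {A B C : Finset α}
    (hA : A ∈ F) (hB : B ∈ F) (hC : C ∈ F) (hiA : i ∈ A) (hjA : j ∈ A)
    (hiB : i ∈ B) (hjB : j ∉ B) (hiC : i ∉ C) (hjC : j ∈ C) : False := by
  have := hF.2 _ (shatters_pair hA hB hC h0 hiA hjA hiB hjB hiC hjC (by simp) (by simp))
  rw [card_pair (by rintro rfl; exact hjB hiB)] at this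
  omega

theorem exists_mem_erase_mem (hF : IsMaximumVCOne F) (i : α) :
    ∃ A ∈ F, i ∈ A ∧ A.erase i ∈ F := by
  have hcard : #(F.image fun A => A.erase i) < #F := by
    have hpos : 0 < Fintype.card α := Fintype.card_pos_iff.2 ⟨i⟩
    have hsub : (F.image fun A => A.erase i).shatterer ⊆
        (univ.erase i).powerset.filter fun t => #t ≤ 1 := by
      intro S hS
      rw [mem_shatterer] at hS
      have hiS : i ∉ S := by
        obtain ⟨A, hA, hSA⟩ := hS.exists_superset
        obtain ⟨B, -, rfl⟩ := mem_image.1 hA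
        exact fun h => by simpa using hSA h
      rw [mem_filter, mem_powerset]
      refine ⟨fun x hx => by simpa using fun h : x = i => hiS (h ▸ hx), hF.2 S fun t ht => ?_⟩
      obtain ⟨A, hA, hSA⟩ := hS ht
      obtain ⟨B, hB, rfl⟩ := mem_image.1 hA
      refine ⟨B, hB, ?_⟩
      rw [← hSA]
      ext x
      simp only [mem_inter, mem_erase]
      have : x ∈ S → x ≠ i := fun hx h => hiS (h ▸ hx)
      tauto
    have h1 := (card_le_card_shatterer _).trans (card_le_card hsub)
    rw [card_filter_card_le_one, card_erase_of_mem (mem_univ i), card_univ] at h1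
    rw [hF.1]
    omega
  obtain ⟨A, hA, B, hB, hne, hAB⟩ := exists_ne_map_eq_of_card_image_lt hcard
  wlog hiA : i ∈ A generalizing A B
  · refine this B hB A hA hne.symm hAB.symm (by_contra fun hiB => hne ?_)
    simpa [erase_eq_of_notMem hiA, erase_eq_of_notMem hiB] using hAB
  refine ⟨A, hA, hiA, ?_⟩
  by_cases hiB : i ∈ B
  · exact absurd (by rw [← insert_erase hiA, ← insert_erase hiB]; exact congrArg _ hAB) hne
  · simp only [erase_eq_of_notMem hiB] at hAB
    rwa [hAB]

/-- A maximum system of VC-dimension one through `∅` consists of the ancestor chains of a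
rooted forest. -/
theorem exists_parent (hF : IsMaximumVCOne F) (h0 : ∅ ∈ F) :
    ∃ p : α → α ⊕ Unit, IsAcyclicParent p ∧ insert ∅ (univ.image (ancestors p)) = F := by
  choose P hPF hmem hPe using hF.exists_mem_erase_mem
  have hinj : Function.Injective P := by
    intro i j hij
    by_contra hne
    exact hF.eq_of_patterns h0 (i := i) (j := j) (hPF i) (hPe j) (hPe i) (hmem i)
      (hij ▸ hmem j) (mem_erase.2 ⟨hne, hij ▸ hmem i⟩) (by simp) (by simp)
      (mem_erase.2 ⟨Ne.symm hne, hij ▸ hmem j⟩)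
  have hFeq : insert ∅ (univ.image P) = F := by
    refine eq_of_subset_of_card_le ?_ ?_
    · intro A hA
      simp only [mem_insert, mem_image, mem_univ, true_and] at hA
      rcases hA with rfl | ⟨i, rfl⟩
      exacts [h0, hPF i]
    · rw [card_insert_of_notMem, card_image_of_injective _ hinj, card_univ, hF.1]
      simp only [mem_image, mem_univ, true_and, not_exists]
      exact fun i h => notMem_empty i (h ▸ hmem i)
  have hp : ∀ i, ∃ c : α ⊕ Unit, (P i).erase i = Sum.elim P (fun _ => ∅) c := by
    intro i
    have := hPe i
    simp only [← hFeq, mem_insert, mem_image, mem_univ, true_and] at this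
    rcases this with h | ⟨j, h⟩
    exacts [⟨Sum.inr (), h⟩, ⟨Sum.inl j, h.symm⟩]
  choose p hp using hp
  obtain ⟨hacyc, hanc⟩ := ancestors_unique hmem hp
  exact ⟨p, hacyc, hanc ▸ hFeq⟩

end IsMaximumVCOne

theorem IsAcyclicParent.isMaximumVCOne {p : α → α ⊕ Unit} (hp : IsAcyclicParent p) :
    IsMaximumVCOne (insert ∅ (univ.image (ancestors p))) := by
  constructor
  · rw [card_insert_of_notMem, card_image_of_injective _ hp.ancestors_injective, card_univ]
    simp only [mem_image, mem_univ, true_and, not_exists]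
    exact fun i h => notMem_empty i (h ▸ self_mem_ancestors)
  · intro S hS
    rw [card_le_one]
    have key : ∀ i ∈ S, ∀ j ∈ S, i ∈ ancestors p j → i = j := by
      intro i hi j hj hij
      obtain ⟨A, hA, hAj⟩ := hS.exists_inter_eq_singleton hj
      have hjA : j ∈ A := (mem_inter.1 (hAj ▸ mem_singleton_self j)).2
      simp only [mem_insert, mem_image, mem_univ, true_and] at hA
      rcases hA with rfl | ⟨k, rfl⟩
      · simp at hjA
      · exact mem_singleton.1 (hAj ▸ mem_inter.2 ⟨hi, ancestors_subset hjA hij⟩)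
    intro i hi j hj
    obtain ⟨A, hA, hSA⟩ := hS.exists_superset
    simp only [mem_insert, mem_image, mem_univ, true_and] at hA
    rcases hA with rfl | ⟨k, rfl⟩
    · simpa using hSA hi
    · rcases ancestors_total (hSA hi) (hSA hj) with h | h
      · exact key i hi j hj h
      · exact (key j hj i hi h).symm

theorem IsAcyclicParent.eq_of_family_eq {p q : α → α ⊕ Unit} (hp : IsAcyclicParent p)
    (hq : IsAcyclicParent q)
    (h : insert ∅ (univ.image (ancestors p)) = insert ∅ (univ.image (ancestors q))) : p = q := by
  have hanc : ancestors p = ancestors q := by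
    funext i
    have hi : ancestors p i ∈ insert ∅ (univ.image (ancestors q)) := by simp [← h]
    have he : (ancestors p i).erase i ∈ insert ∅ (univ.image (ancestors q)) := by
      rw [← h, hp.erase_ancestors]
      rcases p i with c | c <;> simp
    simp only [mem_insert, mem_image, mem_univ, true_and] at hi he
    have hmem : i ∈ ancestors p i := self_mem_ancestors
    rcases hi with hi | ⟨j, hj⟩
    · simp [hi] at hmem
    rw [← hj] at he hmem ⊢
    by_contra hne
    have hji : j ≠ i := fun h => hne (by rw [h])
    have hje : j ∈ (ancestors q j).erase i := mem_erase.2 ⟨hji, self_mem_ancestors⟩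
    rcases he with he | ⟨k, hk⟩
    · simp [he] at hje
    · have := ancestors_subset (hk ▸ hje) hmem
      simp [hk] at this
  funext i
  have := (hp.erase_ancestors i).symm.trans (hanc ▸ hq.erase_ancestors i)
  have hne : ∀ c, ancestors p c ≠ ∅ := fun c hc => notMem_empty c (hc ▸ self_mem_ancestors)
  rcases hpi : p i with a | a <;> rcases hqi : q i with b | b <;>
    simp only [hpi, hqi, Sum.elim_inl, Sum.elim_inr] at this
  · exact congrArg _ (hp.ancestors_injective this)
  · exact absurd this (hne a)
  · exact absurd this.symm (hne b)
  · rfl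

theorem IsMaximumVCOne.image_symmDiff (hF : IsMaximumVCOne F) (A : Finset α) :
    IsMaximumVCOne (F.image (symmDiff A)) := by
  refine ⟨by rw [card_image_of_injective _ (symmDiff_right_injective A), hF.1], fun S hS => ?_⟩
  apply hF.2
  simpa only [image_symmDiff_image_symmDiff] using hS.image_symmDiff A

end SetSystems

open Classical in
theorem card_isMaximumVCOne_empty_mem {α : Type} [Fintype α] [DecidableEq α] [Nonempty α] :
    #(univ.filter fun F : Finset (Finset α) => IsMaximumVCOne F ∧ ∅ ∈ F) =
      (Fintype.card α + 1) ^ (Fintype.card α - 1) := by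
  have h := card_isAcyclicParent _ α Unit rfl
  rw [if_neg Fintype.card_ne_zero, Fintype.card_unit, one_mul, Nat.card_eq_fintype_card,
    Fintype.card_subtype] at h
  rw [← h]
  symm
  refine card_bij (fun p _ => insert ∅ (univ.image (ancestors p))) ?_ ?_ ?_
  · intro p hp
    have hp := (mem_filter.1 hp).2
    simp [hp.isMaximumVCOne]
  · intro p hp q hq h
    exact (mem_filter.1 hp).2.eq_of_family_eq (mem_filter.1 hq).2 h
  · intro F hF
    obtain ⟨-, hF, h0⟩ := mem_filter.1 hF
    obtain ⟨p, hp, rfl⟩ := hF.exists_parent h0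
    exact ⟨p, by simpa using hp, rfl⟩

open Classical in
theorem card_isMaximumVCOne {α : Type} [Fintype α] [DecidableEq α] [Nonempty α] :
    (Fintype.card α + 1) * #(univ.filter fun F : Finset (Finset α) => IsMaximumVCOne F) =
      2 ^ Fintype.card α * (Fintype.card α + 1) ^ (Fintype.card α - 1) := by
  have h := sum_card_bipartiteAbove_eq_sum_card_bipartiteBelow
    (s := univ.filter fun F : Finset (Finset α) => IsMaximumVCOne F)
    (t := (univ : Finset (Finset α))) (fun F A => A ∈ F)
  have hl : ∀ F ∈ univ.filter fun F : Finset (Finset α) => IsMaximumVCOne F,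
      #(bipartiteAbove (fun F A => A ∈ F) univ F) = Fintype.card α + 1 := by
    intro F hF
    rw [← (mem_filter.1 hF).2.1]
    simp [bipartiteAbove]
  have hr : ∀ A ∈ (univ : Finset (Finset α)),
      #(bipartiteBelow (fun F A => A ∈ F)
        (univ.filter fun F : Finset (Finset α) => IsMaximumVCOne F) A) =
      (Fintype.card α + 1) ^ (Fintype.card α - 1) := by
    intro A _
    rw [← card_isMaximumVCOne_empty_mem, bipartiteBelow, filter_filter]
    refine card_bij' (fun F _ => F.image (symmDiff A)) (fun F _ => F.image (symmDiff A))
      ?_ ?_ (fun F _ => image_symmDiff_image_symmDiff A) fun F _ => image_symmDiff_image_symmDiff A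
    · intro F hF
      obtain ⟨-, hF, hA⟩ := mem_filter.1 hF
      exact mem_filter.2 ⟨mem_univ _, hF.image_symmDiff A, mem_image.2 ⟨A, hA, by simp⟩⟩
    · intro F hF
      obtain ⟨-, hF, hA⟩ := mem_filter.1 hF
      exact mem_filter.2 ⟨mem_univ _, hF.image_symmDiff A, mem_image.2 ⟨∅, hA, symmDiff_bot A⟩⟩
  rw [sum_congr rfl hl, sum_congr rfl hr] at h
  simpa [mul_comm] using h

theorem Sh_eq_shatterer (n : ℕ) (F : Finset (Finset (Fin n))) : Sh n F = F.shatterer := by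
  ext S
  simp [Sh, Finset.Shatters, inter_comm]

theorem sExtremal_iff_isMaximumVCOne {n : ℕ} (hn : n ≠ 0) (F : Finset (Finset (Fin n))) :
    (SExtremal n F ∧ (∀ S ∈ Sh n F, #S ≤ 1) ∧ F.sup id = univ ∧ F.inf id = ∅) ↔
      IsMaximumVCOne F := by
  have : Nonempty (Fin n) := ⟨⟨0, Nat.pos_of_ne_zero hn⟩⟩
  have hsmall := card_filter_card_le_one (univ : Finset (Fin n))
  have hmem_inf : ∀ i, i ∈ F.inf id ↔ ∀ A ∈ F, i ∈ A := by
    intro i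
    rw [← singleton_subset_iff, Finset.le_inf_iff]
    simp
  rw [SExtremal, Sh_eq_shatterer]
  simp only [mem_shatterer]
  constructor
  · rintro ⟨hext, hvc, hsup, hinf⟩
    refine ⟨?_, hvc⟩
    rw [← hext, ← card_univ, ← hsmall]
    congr 1
    ext S
    simp only [mem_shatterer, mem_filter, mem_powerset, subset_univ, true_and]
    refine ⟨hvc S, fun hS => ?_⟩
    have hsep : ∀ i, (∃ A ∈ F, i ∈ A) ∧ ∃ A ∈ F, i ∉ A := by
      intro i
      have h1 : i ∈ F.sup id := hsup ▸ mem_univ i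
      have h2 : i ∉ F.inf id := hinf ▸ notMem_empty i
      rw [hmem_inf] at h2
      push Not at h2
      exact ⟨by simpa [mem_sup] using h1, h2⟩
    rcases card_le_one_iff_subset_singleton.1 hS with ⟨i, hi⟩
    refine Finset.Shatters.mono_right hi fun t ht => ?_
    obtain ⟨⟨A, hA, hiA⟩, B, hB, hiB⟩ := hsep i
    rcases subset_singleton_iff.1 ht with rfl | rfl
    · exact ⟨B, hB, singleton_inter_of_notMem hiB⟩
    · exact ⟨A, hA, singleton_inter_of_mem hiA⟩
  · rintro ⟨hcard, hvc⟩
    have hsub : F.shatterer ⊆ univ.powerset.filter fun t => #t ≤ 1 := fun S hS => by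
      simpa using hvc S (mem_shatterer.1 hS)
    have heq : F.shatterer = univ.powerset.filter fun t => #t ≤ 1 := by
      refine eq_of_subset_of_card_le hsub ?_
      rw [hsmall, card_univ, ← hcard]
      exact card_le_card_shatterer F
    have hsing : ∀ i, F.Shatters {i} := fun i => by
      rw [← mem_shatterer, heq]; simp
    refine ⟨by rw [heq, hsmall, hcard, card_univ], hvc, ?_, ?_⟩
    · refine eq_univ_of_forall fun i => ?_
      obtain ⟨A, hA, hiA⟩ := (hsing i).exists_superset
      exact mem_sup.2 ⟨A, hA, hiA (mem_singleton_self i)⟩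
    · refine eq_empty_of_forall_notMem fun i hi => ?_
      obtain ⟨A, hA, hiA⟩ := hsing i (empty_subset _)
      have := (hmem_inf i).1 hi A hA
      simp [this] at hiA

/-- For `n ≥ 2` there are exactly `2^n * (n+1)^(n-2)` s-extremal
set systems of VC-dimension at most 1 with full support and empty common
intersection. -/
theorem stmt2 (n : ℕ) (hn : 2 ≤ n) :
    Set.ncard {F : Finset (Finset (Fin n)) |
        SExtremal n F ∧ (∀ S ∈ Sh n F, S.card ≤ 1) ∧
        F.sup id = Finset.univ ∧ F.inf id = ∅} = 2 ^ n * (n + 1) ^ (n - 2) := by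
  classical
  have : Nonempty (Fin n) := ⟨⟨0, by omega⟩⟩
  have hset : {F : Finset (Finset (Fin n)) |
      SExtremal n F ∧ (∀ S ∈ Sh n F, S.card ≤ 1) ∧
      F.sup id = Finset.univ ∧ F.inf id = ∅} =
      (univ.filter fun F : Finset (Finset (Fin n)) => IsMaximumVCOne F : Finset _) := by
    ext F
    simpa using sExtremal_iff_isMaximumVCOne (by omega) F
  have h := card_isMaximumVCOne (α := Fin n)
  rw [hset, Set.ncard_coe_finset]
  apply Nat.eq_of_mul_eq_mul_left n.succ_pos
  rw [Fintype.card_fin, show n - 1 = n - 2 + 1 by omega, pow_succ] at h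
  rw [Nat.succ_eq_add_one, h]
  ring
end

section
/- Let n ≥ 1 and let T be a tree on a vertex set V with |V| = n+1, equipped with an orientation of its edges and a bijective labelling of its n edges by the elements of [n]. For v ∈ V let F_v ⊆ [n] be the set of labels j such that, writing the edge labelled j as directed from u to w, the vertex v lies in the component of w after deleting this edge (equivalently, v is closer to w than to u in T). Then the sets F_v (v ∈ V) are pairwise distinct, and the set system 𝓕_T = {F_v : v ∈ V} ⊆ 2^[n] is s-extremal of VC-dimension at most 1 with |𝓕_T| = n+1, ∪_{v∈V} F_v = [n] and ∩_{v∈V} F_v = ∅. -/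
open Finset

namespace SimpleGraph

variable {V : Type*} {G : SimpleGraph V}

/-- A vertex at least as close to `w` as to `u` reaches `w` without the edge `s(u, w)`. -/
theorem Connected.reachable_deleteEdges_of_dist_le (hG : G.Connected) {u v w : V} (huw : u ≠ w)
    (h : G.dist v w ≤ G.dist v u) : (G.deleteEdges {s(u, w)}).Reachable v w := by
  classical
  obtain ⟨p, hp⟩ := hG.exists_walk_length_eq_dist v w
  refine ⟨p.toDeleteEdge s(u, w) fun he => ?_⟩
  have hu : u ∈ p.support := p.fst_mem_support_of_mem_edges he
  have hlt := p.length_takeUntil_lt_length hu huw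
  have hle := dist_le (p.takeUntil u hu)
  omega

/-- In a tree, the two sides of an edge are the components left by its deletion. -/
theorem IsTree.reachable_deleteEdges_iff (hG : G.IsTree) {u w : V} (huw : G.Adj u w) (x y : V) :
    (G.deleteEdges {s(u, w)}).Reachable x y ↔
      (G.dist x w < G.dist x u ↔ G.dist y w < G.dist y u) := by
  have hbridge : ¬(G.deleteEdges {s(u, w)}).Reachable u w :=
    isBridge_iff.1 (isAcyclic_iff_forall_isBridge.1 hG.isAcyclic huw)
  have head_side (v : V) (h : G.dist v w < G.dist v u) :
      (G.deleteEdges {s(u, w)}).Reachable v w :=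
    hG.connected.reachable_deleteEdges_of_dist_le huw.ne h.le
  have tail_side (v : V) (h : ¬G.dist v w < G.dist v u) :
      (G.deleteEdges {s(u, w)}).Reachable v u := by
    rw [Sym2.eq_swap]
    exact hG.connected.reachable_deleteEdges_of_dist_le huw.ne' (not_lt.1 h)
  by_cases hx : G.dist x w < G.dist x u <;> by_cases hy : G.dist y w < G.dist y u
  · exact iff_of_true ((head_side x hx).trans (head_side y hy).symm) (by tauto)
  · exact iff_of_false (fun h => hbridge
      ((tail_side y hy).symm.trans (h.symm.trans (head_side x hx)))) (by tauto)
  · exact iff_of_false (fun h => hbridge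
      ((tail_side x hx).symm.trans (h.trans (head_side y hy)))) (by tauto)
  · exact iff_of_true ((tail_side x hx).trans (tail_side y hy).symm) (by tauto)

/-- Deleting an edge of another component does not affect reachability. -/
theorem Reachable.deleteEdges_of_not_reachable {a b x y : V} (hxy : G.Reachable x y)
    (ha : ¬G.Reachable x a) : (G.deleteEdges {s(a, b)}).Reachable x y := by
  classical
  obtain ⟨p⟩ := hxy
  exact ⟨p.toDeleteEdge s(a, b) fun he =>
    ha ⟨p.takeUntil a (p.fst_mem_support_of_mem_edges he)⟩⟩

end SimpleGraph

/-- A directed edge-labelled tree on `n+1` vertices, with all `n`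
edges bijectively labelled by `[n]`, yields an s-extremal set system of
VC-dimension at most 1 of size `n+1` with full support and empty common
intersection; the sets `F_v` are pairwise distinct. -/
theorem stmt3 (n : ℕ) (hn : 1 ≤ n) (V : Type) [Fintype V] [DecidableEq V]
    (T : SimpleGraph V) [DecidableRel T.Adj]
    (hcard : Fintype.card V = n + 1)
    (hconn : T.Connected) (hacyc : T.IsAcyclic)
    (tail head : Fin n → V)
    (hadj : ∀ j, T.Adj (tail j) (head j))
    (hlab : ∀ e ∈ T.edgeSet, ∃! j : Fin n, e = s(tail j, head j))
    (Fv : V → Finset (Fin n))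
    (hFv : ∀ v j, j ∈ Fv v ↔ T.dist v (head j) < T.dist v (tail j)) :
    Function.Injective Fv ∧
      SExtremal n (Finset.univ.image Fv) ∧
      (∀ S ∈ Sh n (Finset.univ.image Fv), S.card ≤ 1) ∧
      (Finset.univ.image Fv).card = n + 1 ∧
      (Finset.univ.image Fv).sup id = Finset.univ ∧
      (Finset.univ.image Fv).inf id = ∅ := by
  classical
  have hT : T.IsTree := ⟨hconn, hacyc⟩
  have side (j : Fin n) (x y : V) :
      (T.deleteEdges {s(tail j, head j)}).Reachable x y ↔ (j ∈ Fv x ↔ j ∈ Fv y) := by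
    rw [hFv, hFv]
    exact hT.reachable_deleteEdges_iff (hadj j) x y
  have hhead (j : Fin n) : j ∈ Fv (head j) := by
    rw [hFv, SimpleGraph.dist_self]
    exact hconn.pos_dist_of_ne (hadj j).ne'
  have htail (j : Fin n) : j ∉ Fv (tail j) := by
    simp [hFv]
  have hinj : Function.Injective Fv := by
    intro a b hab
    obtain ⟨p, hp⟩ := (hconn a b).exists_isPath
    cases p with
    | nil => rfl
    | @cons _ c _ h q =>
      exfalso
      obtain ⟨j, hj, -⟩ := hlab s(a, c) h
      have hq : s(a, c) ∉ q.edges := (SimpleGraph.Walk.isTrail_cons h q).1 hp.isTrail |>.2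
      have hcb : (T.deleteEdges {s(a, c)}).Reachable c b := ⟨q.toDeleteEdge _ hq⟩
      have hac : ¬(T.deleteEdges {s(a, c)}).Reachable a c :=
        SimpleGraph.isBridge_iff.1 (SimpleGraph.isAcyclic_iff_forall_isBridge.1 hacyc h)
      rw [hj, side] at hcb hac
      rw [hab] at hac
      tauto
  have hcardF : (Finset.univ.image Fv).card = n + 1 := by
    rw [Finset.card_image_of_injective _ hinj, Finset.card_univ, hcard]
  have hvc : ∀ S ∈ Sh n (Finset.univ.image Fv), S.card ≤ 1 := by
    intro S hS
    simp only [Sh, Finset.mem_filter, Finset.mem_univ, true_and, Finset.mem_image,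
      Finset.mem_powerset, exists_exists_eq_and] at hS
    rw [Finset.card_le_one]
    intro i hi j hj
    by_contra hij
    have same (x y : V) (hxy : i ∈ Fv x ↔ i ∈ Fv y) (hx : ¬(i ∈ Fv x ↔ i ∈ Fv (tail j))) :
        j ∈ Fv x ↔ j ∈ Fv y := by
      rw [← side] at hxy hx ⊢
      exact (hxy.deleteEdges_of_not_reachable (b := head j) hx).mono
        (SimpleGraph.deleteEdges_mono (SimpleGraph.deleteEdges_le _))
    have trace (H : Finset (Fin n)) (hH : H ⊆ S) :
        ∃ v, (i ∈ Fv v ↔ i ∈ H) ∧ (j ∈ Fv v ↔ j ∈ H) := by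
      obtain ⟨v, hv⟩ := hS H hH
      exact ⟨v, by simp [← hv, hi], by simp [← hv, hj]⟩
    obtain ⟨x₀, hx₀i, hx₀j⟩ := trace ∅ (by simp)
    obtain ⟨x₁, hx₁i, hx₁j⟩ := trace {i} (by simpa)
    obtain ⟨x₂, hx₂i, hx₂j⟩ := trace {j} (by simpa)
    obtain ⟨x₃, hx₃i, hx₃j⟩ := trace {i, j} (by simp [Finset.insert_subset_iff, hi, hj])
    have h₀₂ := same x₀ x₂
    have h₁₃ := same x₁ x₃
    have hji : j ≠ i := Ne.symm hij
    simp only [Finset.notMem_empty, Finset.mem_singleton, Finset.mem_insert, hij, hji, true_or,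
      or_true, iff_true, iff_false] at hx₀i hx₀j hx₁i hx₁j hx₂i hx₂j hx₃i hx₃j
    simp only [hx₀i, hx₀j, hx₁i, hx₁j, hx₂i, hx₂j, hx₃i, hx₃j] at h₀₂ h₁₃
    by_cases hside : i ∈ Fv (tail j) <;> simp [hside] at h₀₂ h₁₃
  have hSh : Sh n (Finset.univ.image Fv) = insert ∅ (Finset.univ.image fun j => {j}) := by
    ext S
    constructor
    · intro hS
      rcases Nat.le_one_iff_eq_zero_or_eq_one.1 (hvc S hS) with h | h
      · simp [Finset.card_eq_zero.1 h]
      · obtain ⟨j, rfl⟩ := Finset.card_eq_one.1 h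
        simp
    · intro hS
      simp only [Sh, Finset.mem_filter, Finset.mem_univ, true_and, Finset.mem_image,
        Finset.mem_powerset, exists_exists_eq_and]
      rcases Finset.mem_insert.1 hS with rfl | hS
      · intro H hH
        obtain ⟨v⟩ := hconn.nonempty
        exact ⟨v, by simp [Finset.subset_empty.1 hH]⟩
      · obtain ⟨j, -, rfl⟩ := Finset.mem_image.1 hS
        intro H hH
        rcases Finset.subset_singleton_iff.1 hH with rfl | rfl
        · exact ⟨tail j, Finset.inter_singleton_of_notMem (htail j)⟩
        · exact ⟨head j, Finset.inter_singleton_of_mem (hhead j)⟩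
  refine ⟨hinj, ?_, hvc, hcardF, ?_, ?_⟩
  · rw [SExtremal, hcardF, hSh, Finset.card_insert_of_notMem (by simp),
      Finset.card_image_of_injective _ Finset.singleton_injective, Finset.card_univ,
      Fintype.card_fin]
  · refine Finset.eq_univ_of_forall fun j => ?_
    exact Finset.le_sup (f := id) (Finset.mem_image_of_mem Fv (Finset.mem_univ (head j)))
      (hhead j)
  · refine Finset.eq_empty_of_forall_notMem fun j hj => ?_
    exact htail j (Finset.inf_le (f := id)
      (Finset.mem_image_of_mem Fv (Finset.mem_univ (tail j))) hj)
end

section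
/- Let 𝓕 ⊆ 2^[n] be s-extremal and i ∈ [n]. Define 𝓕_0^{(i)} = {F ∈ 𝓕 : i ∉ F} and 𝓕_1^{(i)} = {F ∖ {i} : F ∈ 𝓕, i ∈ F}. Then both 𝓕_0^{(i)} and 𝓕_1^{(i)} are s-extremal, and Sh(𝓕) = Sh(𝓕_0^{(i)}) ∪ Sh(𝓕_1^{(i)}) ∪ { S ∪ {i} : S ∈ Sh(𝓕_0^{(i)}) ∩ Sh(𝓕_1^{(i)}) }. -/
open Finset

theorem mem_Sh {n : ℕ} {F : Finset (Finset (Fin n))} {S : Finset (Fin n)} :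
    S ∈ Sh n F ↔ ∀ H ⊆ S, ∃ A ∈ F, A ∩ S = H := by
  simp [Sh]

/-- Pajor's form of the Sauer inequality. -/
theorem card_le_card_Sh (n : ℕ) (F : Finset (Finset (Fin n))) : F.card ≤ (Sh n F).card := by
  rw [Sh_eq_shatterer]
  exact card_le_card_shatterer F

theorem notMem_of_mem_Sh {n : ℕ} {F : Finset (Finset (Fin n))} {i : Fin n}
    (hF : ∀ A ∈ F, i ∉ A) {S : Finset (Fin n)} (hS : S ∈ Sh n F) : i ∉ S := by
  obtain ⟨A, hA, h⟩ := mem_Sh.1 hS S Subset.rfl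
  exact fun hi => hF A hA (mem_inter.1 (h.symm ▸ hi)).1

theorem card_image_erase_filter_mem {n : ℕ} (F : Finset (Finset (Fin n))) (i : Fin n) :
    ((F.filter (fun A => i ∈ A)).image (fun A => A.erase i)).card =
      (F.filter (fun A => i ∈ A)).card := by
  refine card_image_of_injOn fun A hA B hB h => ?_
  rw [← insert_erase (mem_filter.1 hA).2, ← insert_erase (mem_filter.1 hB).2]
  exact congrArg (insert i) h

theorem notMem_of_mem_image_erase {n : ℕ} {F : Finset (Finset (Fin n))} {i : Fin n} :
    ∀ A ∈ F.image (fun A => A.erase i), i ∉ A := by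
  intro A hA
  obtain ⟨B, -, rfl⟩ := mem_image.1 hA
  exact notMem_erase i B

theorem Sh_filter_notMem_subset {n : ℕ} (F : Finset (Finset (Fin n))) (i : Fin n) :
    Sh n (F.filter (fun A => i ∉ A)) ⊆ Sh n F := by
  simp only [Sh_eq_shatterer]
  exact shatterer_mono (filter_subset _ _)

theorem Sh_image_erase_subset {n : ℕ} (F : Finset (Finset (Fin n))) (i : Fin n) :
    Sh n ((F.filter (fun A => i ∈ A)).image (fun A => A.erase i)) ⊆ Sh n F := by
  intro S hS
  have hi : i ∉ S := notMem_of_mem_Sh notMem_of_mem_image_erase hS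
  refine mem_Sh.2 fun H hH => ?_
  obtain ⟨B, hB, h⟩ := mem_Sh.1 hS H hH
  obtain ⟨A, hA, rfl⟩ := mem_image.1 hB
  refine ⟨A, (mem_filter.1 hA).1, ?_⟩
  rw [← h, erase_inter, erase_eq_of_notMem]
  exact fun h => hi (mem_inter.1 h).2

theorem insert_mem_Sh {n : ℕ} {F : Finset (Finset (Fin n))} {i : Fin n} {S : Finset (Fin n)}
    (h₀ : S ∈ Sh n (F.filter (fun A => i ∉ A)))
    (h₁ : S ∈ Sh n ((F.filter (fun A => i ∈ A)).image (fun A => A.erase i))) :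
    insert i S ∈ Sh n F := by
  have hi : i ∉ S := notMem_of_mem_Sh (by simp) h₀
  refine mem_Sh.2 fun H hH => ?_
  by_cases hiH : i ∈ H
  · obtain ⟨B, hB, h⟩ := mem_Sh.1 h₁ (H.erase i) (subset_insert_iff.1 hH)
    obtain ⟨A, hA, rfl⟩ := mem_image.1 hB
    obtain ⟨hAF, hiA⟩ := mem_filter.1 hA
    refine ⟨A, hAF, ?_⟩
    rw [inter_insert_of_mem hiA, ← insert_erase hiH, ← h, erase_inter, erase_eq_of_notMem]
    exact fun h => hi (mem_inter.1 h).2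
  · obtain ⟨A, hA, h⟩ := mem_Sh.1 h₀ H ((subset_insert_iff_of_notMem hiH).1 hH)
    obtain ⟨hAF, hiA⟩ := mem_filter.1 hA
    exact ⟨A, hAF, by rw [inter_insert_of_notMem hiA, h]⟩

/-- For an s-extremal `F`, both restrictions `F₀ⁱ` and `F₁ⁱ` are
s-extremal, and the shattered sets of `F` decompose accordingly. -/
theorem stmt9 (n : ℕ) (F : Finset (Finset (Fin n))) (hext : SExtremal n F) (i : Fin n) :
    SExtremal n (F.filter (fun A => i ∉ A)) ∧
    SExtremal n ((F.filter (fun A => i ∈ A)).image (fun A => A.erase i)) ∧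
    Sh n F =
      Sh n (F.filter (fun A => i ∉ A)) ∪
      Sh n ((F.filter (fun A => i ∈ A)).image (fun A => A.erase i)) ∪
      (Sh n (F.filter (fun A => i ∉ A)) ∩
        Sh n ((F.filter (fun A => i ∈ A)).image (fun A => A.erase i))).image
        (fun S => insert i S) := by
  set F₀ := F.filter (fun A => i ∉ A) with hF₀
  set F₁ := (F.filter (fun A => i ∈ A)).image (fun A => A.erase i) with hF₁
  have hi₀ : ∀ S ∈ Sh n F₀, i ∉ S := fun S => notMem_of_mem_Sh (by simp [hF₀])
  have hi₁ : ∀ S ∈ Sh n F₁, i ∉ S := fun S => notMem_of_mem_Sh notMem_of_mem_image_erase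
  have hsub : Sh n F₀ ∪ Sh n F₁ ∪ (Sh n F₀ ∩ Sh n F₁).image (fun S => insert i S) ⊆ Sh n F := by
    refine union_subset (union_subset (Sh_filter_notMem_subset F i) (Sh_image_erase_subset F i)) ?_
    refine image_subset_iff.2 fun S hS => ?_
    exact insert_mem_Sh (mem_inter.1 hS).1 (mem_inter.1 hS).2
  have hdisj : Disjoint (Sh n F₀ ∪ Sh n F₁)
      ((Sh n F₀ ∩ Sh n F₁).image (fun S => insert i S)) := by
    refine disjoint_left.2 fun S hS hS' => ?_
    obtain ⟨T, -, rfl⟩ := mem_image.1 hS'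
    exact (mem_union.1 hS).elim (fun h => hi₀ _ h (mem_insert_self i T))
      (fun h => hi₁ _ h (mem_insert_self i T))
  have himage : ((Sh n F₀ ∩ Sh n F₁).image (fun S => insert i S)).card =
      (Sh n F₀ ∩ Sh n F₁).card := by
    refine card_image_of_injOn fun S hS T hT h => ?_
    rw [← erase_insert (hi₀ S (mem_inter.1 hS).1), ← erase_insert (hi₀ T (mem_inter.1 hT).1)]
    exact congrArg (fun U => U.erase i) h
  have hcard := card_union_of_disjoint hdisj
  have hunion := card_union_add_card_inter (Sh n F₀) (Sh n F₁)
  have hsplit : F₁.card + F₀.card = F.card := by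
    rw [hF₁, card_image_erase_filter_mem]
    exact card_filter_add_card_filter_not (fun A => i ∈ A)
  have hle := card_le_card hsub
  have h₀ := card_le_card_Sh n F₀
  have h₁ := card_le_card_Sh n F₁
  unfold SExtremal at hext ⊢
  exact ⟨by omega, by omega, (eq_of_subset_of_card_le hsub (by omega)).symm⟩
end

section
/- Let 𝓕 ⊆ 2^[n] and i ∈ [n], and define the downshift D_i(𝓕) = {F ∖ {i} : F ∈ 𝓕} ∪ {F ∈ 𝓕 : i ∈ F and F ∖ {i} ∈ 𝓕}. If 𝓕 is s-extremal, then D_i(𝓕) is s-extremal. -/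
open Finset

open scoped FinsetFamily in
theorem downshift_eq_compression {α : Type*} [DecidableEq α] (F : Finset (Finset α)) (a : α) :
    F.image (fun A => A.erase a) ∪ F.filter (fun A => a ∈ A ∧ A.erase a ∈ F) = 𝓓 a F := by
  ext s
  simp only [mem_union, mem_image, mem_filter, Down.mem_compression]
  constructor
  · rintro (⟨A, hA, rfl⟩ | ⟨hs, -, hs'⟩)
    · by_cases ha : a ∈ A
      · by_cases h : A.erase a ∈ F
        · exact Or.inl ⟨h, by simpa using h⟩
        · exact Or.inr ⟨h, by rwa [insert_erase ha]⟩
      · simp [erase_eq_of_notMem ha, hA]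
    · exact Or.inl ⟨hs, hs'⟩
  · rintro (⟨hs, hs'⟩ | ⟨hs, hs'⟩)
    · by_cases ha : a ∈ s
      · exact Or.inr ⟨hs, ha, hs'⟩
      · exact Or.inl ⟨s, hs, erase_eq_of_notMem ha⟩
    · have ha : a ∉ s := fun ha => hs (by rwa [insert_eq_of_mem ha] at hs')
      exact Or.inl ⟨insert a s, hs', erase_insert ha⟩

/-- The downshift operation preserves s-extremality. -/
theorem stmt10 (n : ℕ) (F : Finset (Finset (Fin n))) (i : Fin n)
    (hext : SExtremal n F) :
    SExtremal n ((F.image (fun A => A.erase i)) ∪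
      (F.filter (fun A => i ∈ A ∧ A.erase i ∈ F))) := by
  rw [downshift_eq_compression]
  unfold SExtremal at hext ⊢
  rw [Sh_eq_shatterer] at hext ⊢
  refine le_antisymm ?_ (card_le_card_shatterer _)
  rw [Down.card_compression, ← hext]
  exact card_le_card (shatterer_compress_subset_shatterer i F)
end

section
/- Let 𝓕 ⊆ 2^[n] be s-extremal and i ∈ [n]. With 𝓕_0^{(i)} = {F ∈ 𝓕 : i ∉ F} and 𝓕_1^{(i)} = {F ∖ {i} : F ∈ 𝓕, i ∈ F}, the intersection M_i(𝓕) = 𝓕_0^{(i)} ∩ 𝓕_1^{(i)} is s-extremal. -/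
open Finset

theorem Finset.Shatters.notMem_of_forall_notMem {α : Type*} [DecidableEq α]
    {𝒜 : Finset (Finset α)} {a : α} {s : Finset α} (hs : 𝒜.Shatters s)
    (h : ∀ t ∈ 𝒜, a ∉ t) : a ∉ s := by
  obtain ⟨t, ht, hst⟩ := hs.exists_superset
  exact fun ha => h t ht (hst ha)

theorem Finset.notMem_of_mem_union_subfamilies {α : Type*} [DecidableEq α]
    {𝒜 : Finset (Finset α)} {a : α} {t : Finset α}
    (ht : t ∈ 𝒜.nonMemberSubfamily a ∪ 𝒜.memberSubfamily a) : a ∉ t := by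
  rw [mem_union, mem_nonMemberSubfamily, mem_memberSubfamily] at ht
  exact ht.elim And.right And.right

/-- A set shattered by the projection of `𝒜` along `a` is shattered by `𝒜`. -/
theorem Finset.Shatters.of_union_subfamilies {α : Type*} [DecidableEq α]
    {𝒜 : Finset (Finset α)} {a : α} {s : Finset α}
    (hs : (𝒜.nonMemberSubfamily a ∪ 𝒜.memberSubfamily a).Shatters s) : 𝒜.Shatters s := by
  have ha : a ∉ s := hs.notMem_of_forall_notMem fun _ => notMem_of_mem_union_subfamilies
  intro t ht
  obtain ⟨u, hu, rfl⟩ := hs ht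
  rw [mem_union, mem_nonMemberSubfamily, mem_memberSubfamily] at hu
  obtain hu | hu := hu
  · exact ⟨u, hu.1, rfl⟩
  · exact ⟨insert a u, hu.1, inter_insert_of_notMem ha⟩

/-- If the link intersection of `𝒜` at `a` shatters `s`, then `𝒜` shatters `insert a s`. -/
theorem Finset.Shatters.insert_of_inter_subfamilies {α : Type*} [DecidableEq α]
    {𝒜 : Finset (Finset α)} {a : α} {s : Finset α}
    (hs : (𝒜.nonMemberSubfamily a ∩ 𝒜.memberSubfamily a).Shatters s) :
    𝒜.Shatters (insert a s) := by
  intro t ht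
  obtain ⟨u, hu, hsu⟩ := hs (subset_insert_iff.1 ht)
  rw [mem_inter, mem_nonMemberSubfamily, mem_memberSubfamily] at hu
  by_cases ha : a ∈ t
  · exact ⟨insert a u, hu.2.1, by rw [← insert_inter_distrib, hsu, insert_erase ha]⟩
  · exact ⟨u, hu.1.1, by rw [insert_inter_of_notMem hu.1.2, hsu, erase_eq_of_notMem ha]⟩

theorem Finset.card_shatterer_union_add_card_shatterer_inter_le {α : Type*} [DecidableEq α]
    (𝒜 : Finset (Finset α)) (a : α) :
    (𝒜.nonMemberSubfamily a ∪ 𝒜.memberSubfamily a).shatterer.card +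
      (𝒜.nonMemberSubfamily a ∩ 𝒜.memberSubfamily a).shatterer.card ≤ 𝒜.shatterer.card := by
  have hinj : Set.InjOn (insert a)
      ((𝒜.nonMemberSubfamily a ∩ 𝒜.memberSubfamily a).shatterer : Set (Finset α)) := by
    refine insert_erase_invOn.2.injOn.mono fun s hs => ?_
    exact (mem_shatterer.1 hs).notMem_of_forall_notMem fun t ht =>
      notMem_of_mem_union_subfamilies (inter_subset_union ht)
  rw [← card_image_of_injOn hinj, ← card_union_of_disjoint]
  · refine card_le_card (union_subset (fun s hs => ?_) (forall_mem_image.2 fun s hs => ?_))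
    · exact mem_shatterer.2 (mem_shatterer.1 hs).of_union_subfamilies
    · exact mem_shatterer.2 (mem_shatterer.1 hs).insert_of_inter_subfamilies
  · rw [disjoint_right, forall_mem_image]
    intro s _ hs
    exact (mem_shatterer.1 hs).notMem_of_forall_notMem
      (fun _ => notMem_of_mem_union_subfamilies) (mem_insert_self a s)

/-- For an s-extremal `F`, the intersection
`M_i(F) = F₀ⁱ ∩ F₁ⁱ` is s-extremal. -/
theorem stmt11 (n : ℕ) (F : Finset (Finset (Fin n))) (i : Fin n)
    (hext : SExtremal n F) :
    SExtremal n ((F.filter (fun A => i ∉ A)) ∩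
      ((F.filter (fun A => i ∈ A)).image (fun A => A.erase i))) := by
  change SExtremal n (F.nonMemberSubfamily i ∩ F.memberSubfamily i)
  rw [SExtremal, Sh_eq_shatterer] at hext ⊢
  have hshatter := card_shatterer_union_add_card_shatterer_inter_le F i
  have hunion := card_le_card_shatterer (F.nonMemberSubfamily i ∪ F.memberSubfamily i)
  have hinter := card_le_card_shatterer (F.nonMemberSubfamily i ∩ F.memberSubfamily i)
  have hcard := card_union_add_card_inter (F.nonMemberSubfamily i) (F.memberSubfamily i)
  have hsplit := card_memberSubfamily_add_card_nonMemberSubfamily i F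
  omega
end

section
/- Let 𝓕 ⊆ 2^[n] be s-extremal and i ∈ [n]. With 𝓕_0^{(i)} = {F ∈ 𝓕 : i ∉ F} and 𝓕_1^{(i)} = {F ∖ {i} : F ∈ 𝓕, i ∈ F}, the union U_i(𝓕) = 𝓕_0^{(i)} ∪ 𝓕_1^{(i)} is s-extremal. -/
open Finset

section Projection
variable {α : Type*} [DecidableEq α] {a : α} {𝒜 : Finset (Finset α)} {s : Finset α}

theorem notMem_of_shatters (h : ∀ t ∈ 𝒜, a ∉ t) (hs : 𝒜.Shatters s) : a ∉ s := by
  obtain ⟨t, ht, hst⟩ := hs.exists_superset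
  exact fun ha => h t ht (hst ha)

/-- A set shattered by the projection of `𝒜` away from `a` is shattered by `𝒜` and avoids `a`. -/
theorem shatterer_memberSubfamily_union_nonMemberSubfamily_subset (a : α)
    (𝒜 : Finset (Finset α)) :
    (𝒜.memberSubfamily a ∪ 𝒜.nonMemberSubfamily a).shatterer ⊆
      𝒜.shatterer.nonMemberSubfamily a := by
  intro s hs
  rw [mem_shatterer] at hs
  have ha : a ∉ s := by
    refine notMem_of_shatters (fun t ht => ?_) hs
    rw [mem_union, mem_memberSubfamily, mem_nonMemberSubfamily] at ht
    exact ht.elim And.right And.right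
  rw [mem_nonMemberSubfamily, mem_shatterer]
  refine ⟨fun t ht => ?_, ha⟩
  obtain ⟨u, hu, rfl⟩ := hs ht
  rw [mem_union, mem_memberSubfamily, mem_nonMemberSubfamily] at hu
  rcases hu with hu | hu
  · exact ⟨insert a u, hu.1, inter_insert_of_notMem ha⟩
  · exact ⟨u, hu.1, rfl⟩

/-- Adjoining `a` to a set shattered by the sets `t` with both `t` and `insert a t` in `𝒜`
gives a set shattered by `𝒜`. -/
theorem shatterer_memberSubfamily_inter_nonMemberSubfamily_subset (a : α)
    (𝒜 : Finset (Finset α)) :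
    (𝒜.memberSubfamily a ∩ 𝒜.nonMemberSubfamily a).shatterer ⊆
      𝒜.shatterer.memberSubfamily a := by
  intro s hs
  rw [mem_shatterer] at hs
  have ha : a ∉ s := by
    refine notMem_of_shatters (fun t ht => ?_) hs
    exact (mem_memberSubfamily.1 (mem_inter.1 ht).1).2
  rw [mem_memberSubfamily, mem_shatterer]
  refine ⟨fun t ht => ?_, ha⟩
  obtain ⟨u, hu, hsu⟩ := hs (subset_insert_iff.1 ht)
  rw [mem_inter, mem_memberSubfamily, mem_nonMemberSubfamily] at hu
  by_cases hat : a ∈ t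
  · exact ⟨insert a u, hu.1.1, by rw [← insert_inter_distrib, hsu, insert_erase hat]⟩
  · exact ⟨u, hu.2.1, by rw [insert_inter_of_notMem hu.2.2, hsu, erase_eq_of_notMem hat]⟩

theorem card_shatterer_memberSubfamily_union_nonMemberSubfamily (a : α)
    (h : #𝒜.shatterer = #𝒜) :
    #(𝒜.memberSubfamily a ∪ 𝒜.nonMemberSubfamily a).shatterer =
      #(𝒜.memberSubfamily a ∪ 𝒜.nonMemberSubfamily a) := by
  have h₁ := card_le_card (shatterer_memberSubfamily_union_nonMemberSubfamily_subset a 𝒜)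
  have h₂ := card_le_card (shatterer_memberSubfamily_inter_nonMemberSubfamily_subset a 𝒜)
  have h₃ := card_le_card_shatterer (𝒜.memberSubfamily a ∪ 𝒜.nonMemberSubfamily a)
  have h₄ := card_le_card_shatterer (𝒜.memberSubfamily a ∩ 𝒜.nonMemberSubfamily a)
  have h₅ := card_memberSubfamily_add_card_nonMemberSubfamily a 𝒜
  have h₆ := card_memberSubfamily_add_card_nonMemberSubfamily a 𝒜.shatterer
  have h₇ := card_union_add_card_inter (𝒜.memberSubfamily a) (𝒜.nonMemberSubfamily a)
  omega

end Projection

/-- For an s-extremal `F`, the union `U_i(F) = F₀ⁱ ∪ F₁ⁱ` is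
s-extremal. -/
theorem stmt12 (n : ℕ) (F : Finset (Finset (Fin n))) (i : Fin n)
    (hext : SExtremal n F) :
    SExtremal n ((F.filter (fun A => i ∉ A)) ∪
      ((F.filter (fun A => i ∈ A)).image (fun A => A.erase i))) := by
  unfold SExtremal at *
  rw [Sh_eq_shatterer] at *
  rw [union_comm]
  exact card_shatterer_memberSubfamily_union_nonMemberSubfamily i hext
end

section
/- Let 𝓕 ⊆ 2^[n] be s-extremal and B ⊆ [n]. Then the set system 𝓕(B) = { I ⊆ [n] ∖ B : I ∪ H ∈ 𝓕 for every H ⊆ B } is s-extremal. -/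
open Finset

/-- The system `F(B) = { I ⊆ [n] \ B : I ∪ H ∈ F for all H ⊆ B }`. -/
def sysB (n : ℕ) (F : Finset (Finset (Fin n))) (B : Finset (Fin n)) :
    Finset (Finset (Fin n)) :=
  Bᶜ.powerset.filter (fun I => ∀ H ∈ B.powerset, I ∪ H ∈ F)

/-- A set shattered by the projection of `𝒜` away from `a` avoids `a` and is shattered by `𝒜`. -/
theorem shatterer_union_subfamilies_subset {α : Type*} [DecidableEq α] (a : α)
    (𝒜 : Finset (Finset α)) :
    (𝒜.nonMemberSubfamily a ∪ 𝒜.memberSubfamily a).shatterer ⊆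
      {s ∈ 𝒜.shatterer | a ∉ s} := by
  intro s hs
  rw [mem_shatterer] at hs
  have has : a ∉ s := by
    obtain ⟨t, ht, hst⟩ := hs.exists_superset
    simp only [mem_union, mem_nonMemberSubfamily, mem_memberSubfamily] at ht
    rcases ht with ht | ht
    · exact fun h => ht.2 (hst h)
    · exact fun h => ht.2 (hst h)
  rw [mem_filter, mem_shatterer]
  refine ⟨fun t ht => ?_, has⟩
  obtain ⟨u, hu, hut⟩ := hs ht
  simp only [mem_union, mem_nonMemberSubfamily, mem_memberSubfamily] at hu
  rcases hu with hu | hu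
  · exact ⟨u, hu.1, hut⟩
  · exact ⟨insert a u, hu.1, by rw [inter_insert_of_notMem has, hut]⟩

/-- If `s` is shattered by the sets `I` avoiding `a` with `I` and `insert a I` both in `𝒜`, then
`insert a s` is shattered by `𝒜`. -/
theorem shatters_insert_of_shatters_inter {α : Type*} [DecidableEq α] {a : α}
    {𝒜 : Finset (Finset α)} {s : Finset α}
    (hs : (𝒜.nonMemberSubfamily a ∩ 𝒜.memberSubfamily a).Shatters s) :
    a ∉ s ∧ 𝒜.Shatters (insert a s) := by
  have has : a ∉ s := by
    obtain ⟨t, ht, hst⟩ := hs.exists_superset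
    simp only [mem_inter, mem_nonMemberSubfamily] at ht
    exact fun h => ht.1.2 (hst h)
  refine ⟨has, fun t ht => ?_⟩
  obtain ⟨u, hu, hut⟩ := hs (subset_insert_iff.1 ht)
  simp only [mem_inter, mem_nonMemberSubfamily, mem_memberSubfamily] at hu
  by_cases hat : a ∈ t
  · refine ⟨insert a u, hu.2.1, ?_⟩
    rw [← insert_inter_distrib, hut, insert_erase hat]
  · refine ⟨u, hu.1.1, ?_⟩
    rw [insert_inter_of_notMem hu.1.2, hut, erase_eq_of_notMem hat]

theorem card_shatterer_inter_subfamilies {α : Type*} [DecidableEq α] (a : α)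
    {𝒜 : Finset (Finset α)} (h : #𝒜.shatterer = #𝒜) :
    #(𝒜.nonMemberSubfamily a ∩ 𝒜.memberSubfamily a).shatterer =
      #(𝒜.nonMemberSubfamily a ∩ 𝒜.memberSubfamily a) := by
  have h_split := card_filter_add_card_filter_not (s := 𝒜.shatterer) (fun s => a ∈ s)
  have h_card := card_memberSubfamily_add_card_nonMemberSubfamily a 𝒜
  have h_union := card_union_add_card_inter (𝒜.nonMemberSubfamily a) (𝒜.memberSubfamily a)
  have h_avoid := (card_le_card_shatterer _).trans
    (card_le_card (shatterer_union_subfamilies_subset a 𝒜))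
  have h_sauer := card_le_card_shatterer (𝒜.nonMemberSubfamily a ∩ 𝒜.memberSubfamily a)
  have h_insert : #(𝒜.nonMemberSubfamily a ∩ 𝒜.memberSubfamily a).shatterer ≤
      #{s ∈ 𝒜.shatterer | a ∈ s} := by
    refine card_le_card_of_injOn (insert a) (fun s hs => ?_) (fun s hs t ht hst => ?_)
    · have := shatters_insert_of_shatters_inter (mem_shatterer.1 hs)
      simpa using this.2
    · have hs' := (shatters_insert_of_shatters_inter (mem_shatterer.1 hs)).1
      have ht' := (shatters_insert_of_shatters_inter (mem_shatterer.1 ht)).1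
      rw [← erase_insert hs', hst, erase_insert ht']
  omega

theorem sysB_insert (n : ℕ) (F : Finset (Finset (Fin n))) {a : Fin n} {B : Finset (Fin n)}
    (ha : a ∉ B) :
    sysB n F (insert a B) =
      (sysB n F B).nonMemberSubfamily a ∩ (sysB n F B).memberSubfamily a := by
  ext I
  simp only [sysB, mem_filter, mem_powerset, mem_inter, mem_nonMemberSubfamily,
    mem_memberSubfamily, subset_compl_iff_disjoint_right, disjoint_insert_left,
    disjoint_insert_right]
  constructor
  · rintro ⟨⟨haI, hIB⟩, h⟩
    refine ⟨⟨⟨hIB, fun H hH => h H (hH.trans (subset_insert a B))⟩, haI⟩,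
      ⟨⟨ha, hIB⟩, fun H hH => ?_⟩, haI⟩
    rw [insert_union, ← union_insert]
    exact h _ (insert_subset_insert a hH)
  · rintro ⟨⟨⟨hIB, h⟩, haI⟩, ⟨-, h'⟩, -⟩
    refine ⟨⟨haI, hIB⟩, fun H hH => ?_⟩
    have hHB := subset_insert_iff.1 hH
    by_cases haH : a ∈ H
    · have := h' _ hHB
      rwa [insert_union, ← union_insert, insert_erase haH] at this
    · rw [erase_eq_of_notMem haH] at hHB
      exact h H hHB

/-- If `F` is s-extremal then so is `F(B)` for every `B ⊆ [n]`. -/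
theorem stmt14 (n : ℕ) (F : Finset (Finset (Fin n))) (hext : SExtremal n F)
    (B : Finset (Fin n)) :
    SExtremal n (sysB n F B) := by
  induction B using Finset.induction_on with
  | empty =>
    have h : sysB n F ∅ = F := by
      ext I
      simp [sysB]
    rwa [h]
  | insert a B ha ih =>
    rw [SExtremal, Sh_eq_shatterer] at ih ⊢
    rw [sysB_insert n F ha]
    exact card_shatterer_inter_subfamilies a ih
end
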